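/- Let q₁ < q₂ < … denote the primes in increasing order, let r ≥ 64 be an integer, and let h₁, …, h_r be a non-increasing sequence of integers with 1 ≤ h_i ≤ r/i for 1 ≤ i ≤ r. If m is an integer with 2·√r·log₂ r < m and m + 1 ≤ r, then (h_{m+1} · log₂ q_{m+1})² < 4 · ∑_{i=1}^m h_i · log₂(q_i). -/

import Mathlib

open Real in
theorem le_primeCounting_sq {n : ℕ} (hn : 64 ≤ n) : n ≤ Nat.primeCounting (n ^ 2) := by
  have hn' : (64 : ℝ) ≤ n := by exact_mod_cast hn
  have hlog : log n ≤ n / 4 := by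
    have hs : 8 ≤ √(n : ℝ) := Real.le_sqrt_of_sq_le (by linarith)
    have h1 := log_le_sub_one_of_pos (show 0 < √(n : ℝ) by linarith)
    rw [log_sqrt (by positivity)] at h1
    nlinarith [sq_sqrt (show (0 : ℝ) ≤ n by positivity)]
  have hsq : log ((n : ℝ) ^ 2 + 1) ≤ 3 * log n := by
    have h3 : 3 * log (n : ℝ) = log ((n : ℝ) ^ 3) := by simp
    rw [h3]
    exact log_le_log (by positivity) (by nlinarith [sq_nonneg (n : ℝ)])
  have hpos : 0 < log ((n : ℝ) ^ 2) := log_pos (by nlinarith)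
  have hpi := Chebyshev.pi_ge (n ^ 2)
  push_cast at hpi
  have key : (n : ℝ) ≤ ((n : ℝ) ^ 2 * log 2 - log ((n : ℝ) ^ 2 + 1)) / log ((n : ℝ) ^ 2) := by
    rw [le_div_iff₀ hpos, log_pow]
    push_cast
    nlinarith [log_two_gt_d9, mul_le_mul_of_nonneg_left hlog (show (0 : ℝ) ≤ n by positivity),
      mul_le_mul_of_nonneg_left log_two_gt_d9.le (sq_nonneg (n : ℝ))]
  exact_mod_cast key.trans hpi

theorem nth_prime_le_sq {m n : ℕ} (hn : 64 ≤ n) (hmn : m < n) :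
    Nat.nth Nat.Prime m ≤ n ^ 2 :=
  Nat.lt_succ_iff.mp (Nat.nth_lt_of_lt_count (hmn.trans_le (le_primeCounting_sq hn)))

theorem one_le_logb_two_nth_prime (n : ℕ) : 1 ≤ Real.logb 2 (Nat.nth Nat.Prime n) := by
  have hp : (2 : ℝ) ≤ Nat.nth Nat.Prime n := by exact_mod_cast (Nat.prime_nth_prime n).two_le
  rw [Real.le_logb_iff_rpow_le (by norm_num) (by linarith), Real.rpow_one]
  exact hp


/-- Let `q_i` be the `i`-th prime, `r ≥ 64`, and `h₁ ≥ h₂ ≥ … ≥ h_r` positive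
integers with `h_i ≤ r/i`.  If `2·√r·log₂ r < m` and `m + 1 ≤ r`, then
`(h_{m+1} log₂ q_{m+1})² < 4 ∑_{i=1}^m h_i log₂ q_i`. -/
theorem distinguished_element_bound
    (r : ℕ) (hr : 64 ≤ r) (h : ℕ → ℕ)
    (hmono : ∀ i ∈ Finset.Icc 1 r, ∀ j ∈ Finset.Icc 1 r, i ≤ j → h j ≤ h i)
    (hh : ∀ i ∈ Finset.Icc 1 r, 1 ≤ h i ∧ (h i : ℝ) ≤ (r : ℝ) / i)
    (m : ℕ) (hm : 2 * Real.sqrt r * Real.logb 2 r < m) (hmr : m + 1 ≤ r) :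
    ((h (m + 1) : ℝ) * Real.logb 2 (Nat.nth Nat.Prime (m + 1 - 1))) ^ 2
      < 4 * ∑ i ∈ Finset.Icc 1 m, (h i : ℝ) * Real.logb 2 (Nat.nth Nat.Prime (i - 1)) := by
  rw [Nat.add_sub_cancel]
  obtain ⟨hH1, hH⟩ := hh (m + 1) (by simp [hmr])
  have hr' : (64 : ℝ) ≤ r := by exact_mod_cast hr
  have hH1' : (1 : ℝ) ≤ h (m + 1) := by exact_mod_cast hH1
  have hLq : Real.logb 2 (Nat.nth Nat.Prime m) ≤ 2 * Real.logb 2 r := by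
    have hq : (Nat.nth Nat.Prime m : ℝ) ≤ (r : ℝ) ^ 2 := by
      exact_mod_cast nth_prime_le_sq hr (by omega)
    calc Real.logb 2 (Nat.nth Nat.Prime m) ≤ Real.logb 2 ((r : ℝ) ^ 2) :=
          Real.logb_le_logb_of_le (by norm_num)
            (by exact_mod_cast (Nat.prime_nth_prime m).pos) hq
      _ = 2 * Real.logb 2 r := by rw [Real.logb_pow]; norm_num
  have hsum : (m : ℝ) * h (m + 1) ≤
      ∑ i ∈ Finset.Icc 1 m, (h i : ℝ) * Real.logb 2 (Nat.nth Nat.Prime (i - 1)) := by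
    have hterm : ∀ i ∈ Finset.Icc 1 m,
        (h (m + 1) : ℝ) ≤ (h i : ℝ) * Real.logb 2 (Nat.nth Nat.Prime (i - 1)) := by
      intro i hi
      rw [Finset.mem_Icc] at hi
      have hle : (h (m + 1) : ℝ) ≤ h i := by
        exact_mod_cast hmono i (Finset.mem_Icc.mpr ⟨hi.1, by omega⟩) (m + 1)
          (Finset.mem_Icc.mpr ⟨by omega, hmr⟩) (by omega)
      exact hle.trans (le_mul_of_one_le_right (by positivity) (one_le_logb_two_nth_prime _))
    simpa using Finset.card_nsmul_le_sum _ _ _ hterm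
  have hLq1 := one_le_logb_two_nth_prime m
  have hs : 0 < √(r : ℝ) := Real.sqrt_pos.mpr (by linarith)
  have hs2 := Real.sq_sqrt (show (0 : ℝ) ≤ r by positivity)
  rw [le_div_iff₀ (by positivity)] at hH
  push_cast at hH
  generalize Real.logb 2 (Nat.nth Nat.Prime m) = q at *
  generalize Real.logb 2 (r : ℝ) = L at *
  generalize (h (m + 1) : ℝ) = H at *
  generalize √(r : ℝ) = s at *
  have hL : 0 < L := by linarith
  have hHL : 2 * H * L < s := by
    refine lt_of_mul_lt_mul_right ?_ hs.le
    nlinarith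
  have hq2 : q ^ 2 ≤ (2 * L) ^ 2 := by gcongr
  have hHq : H * q ^ 2 < m := by
    nlinarith [mul_le_mul_of_nonneg_left hq2 (show 0 ≤ H by linarith),
      mul_lt_mul_of_pos_right hHL hL]
  have hm0 : (0 : ℝ) ≤ m := by positivity
  nlinarith [mul_lt_mul_of_pos_left hHq (show 0 < H by linarith)]
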